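/- For every d ≥ 2, the quantum state space S(ℂ^d) of d×d density matrices has no quasi-classical structure: there is no partition of the set of pure states (rank-one orthogonal projections) into K ≥ 2 nonempty classes S_1, …, S_K together with a POVM {A_k}_{k=1}^K (Hermitian matrices with A_k ≥ 0 and Σ_k A_k = 1) such that tr(A_k ρ) = δ_{kk'} for every pure state ρ ∈ S_{k'}. -/

import Mathlib

open scoped ComplexOrder

open scoped Matrix

/-- The rank-one projection onto the line spanned by a nonzero vector is a pure state. -/
theorem Matrix.smul_vecMulVec_star_isPure {n : Type*} [Fintype n] {v : n → ℂ} (hv : v ≠ 0) :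
    ((star v ⬝ᵥ v)⁻¹ • vecMulVec v (star v)).PosSemidef ∧
      ((star v ⬝ᵥ v)⁻¹ • vecMulVec v (star v)).trace = 1 ∧
      ((star v ⬝ᵥ v)⁻¹ • vecMulVec v (star v)) * ((star v ⬝ᵥ v)⁻¹ • vecMulVec v (star v)) =
        (star v ⬝ᵥ v)⁻¹ • vecMulVec v (star v) := by
  have hc : star v ⬝ᵥ v ≠ 0 := fun h => hv (dotProduct_star_self_eq_zero.1 h)
  have hc0 : 0 ≤ (star v ⬝ᵥ v)⁻¹ := inv_nonneg.2 (dotProduct_star_self_nonneg v)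
  refine ⟨(posSemidef_vecMulVec_self_star v).smul hc0, ?_, ?_⟩
  · rw [trace_smul, trace_vecMulVec, dotProduct_comm v, smul_eq_mul, inv_mul_cancel₀ hc]
  · rw [smul_mul_smul_comm, vecMulVec_mul_vecMulVec, vecMulVec_smul, smul_smul]
    congr 1
    field_simp

/-- The expectation of `A` in the pure state spanned by `v`. -/
theorem Matrix.trace_mul_smul_vecMulVec_star {n : Type*} [Fintype n] (A : Matrix n n ℂ)
    (v : n → ℂ) (c : ℂ) :
    (A * (c • vecMulVec v (star v))).trace = c * (star v ⬝ᵥ (A *ᵥ v)) := by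
  rw [Matrix.mul_smul, trace_smul, mul_vecMulVec, trace_vecMulVec, dotProduct_comm, smul_eq_mul]

/-- If every vector is either killed or fixed by `A`, then `A` is `0` or `1`. -/
theorem Matrix.eq_zero_or_eq_one_of_mulVec {n R : Type*} [Fintype n] [DecidableEq n] [CommRing R]
    {A : Matrix n n R} (h : ∀ v, A *ᵥ v = 0 ∨ A *ᵥ v = v) : A = 0 ∨ A = 1 := by
  by_contra! hA
  obtain ⟨v, hv⟩ : ∃ v, A *ᵥ v ≠ 0 := by
    by_contra! h0
    exact hA.1 (ext_of_mulVec_single fun i => by rw [h0, zero_mulVec])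
  obtain ⟨w, hw⟩ : ∃ w, A *ᵥ w ≠ w := by
    by_contra! h1
    exact hA.2 (ext_of_mulVec_single fun i => by rw [h1, one_mulVec])
  have hAv : A *ᵥ v = v := (h v).resolve_left hv
  have hAw : A *ᵥ w = 0 := (h w).resolve_right hw
  rcases h (v + w) with h' | h' <;> rw [mulVec_add, hAv, hAw, add_zero] at h'
  · exact hv (hAv.trans h')
  · exact hw (hAw.trans (left_eq_add.1 h').symm)

/-- The quantum state space `S(ℂ^d)` (`d ≥ 2`) has no quasi-classical structure: there is
no partition of the pure states (positive semidefinite, trace-one, idempotent matrices,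
i.e. rank-one orthogonal projections) into `K ≥ 2` nonempty classes together with a POVM
`{A_k}` satisfying `tr(A_k ρ) = δ_{k k'}` for every pure state `ρ` in class `k'`. -/
theorem quantum_no_quasiClassical (d : ℕ) (hd : 2 ≤ d) :
    ¬ ∃ (K : ℕ) (_ : 2 ≤ K) (S : Fin K → Set (Matrix (Fin d) (Fin d) ℂ))
        (A : Fin K → Matrix (Fin d) (Fin d) ℂ),
      (∀ k, (S k).Nonempty) ∧
      (Pairwise fun k k' => Disjoint (S k) (S k')) ∧
      (⋃ k, S k) = {ρ : Matrix (Fin d) (Fin d) ℂ |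
        ρ.PosSemidef ∧ ρ.trace = 1 ∧ ρ * ρ = ρ} ∧
      (∀ k, (A k).PosSemidef) ∧ (∑ k, A k) = 1 ∧
      ∀ k k' : Fin K, ∀ ρ ∈ S k', (A k * ρ).trace = if k = k' then 1 else 0 := by
  rintro ⟨K, hK, S, A, hne, -, hS, hA, hsum, htr⟩
  let a : Fin K := ⟨0, by omega⟩
  let b : Fin K := ⟨1, by omega⟩
  have hpure : ∀ {k ρ}, ρ ∈ S k → ρ.trace = 1 := fun {k ρ} hρ =>
    (hS.subset (Set.mem_iUnion.2 ⟨k, hρ⟩)).2.1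
  obtain ⟨ρ, hρ⟩ := hne a
  obtain ⟨σ, hσ⟩ := hne b
  have haρ := htr a a ρ hρ
  have haσ := htr a b σ hσ
  rw [if_pos rfl] at haρ
  rw [if_neg (by simp [a, b])] at haσ
  have key : ∀ v, A a *ᵥ v = 0 ∨ A a *ᵥ v = v := by
    intro v
    by_cases hv : v = 0
    · simp [hv]
    obtain ⟨k, hk⟩ := Set.mem_iUnion.1 (hS.superset (Matrix.smul_vecMulVec_star_isPure hv))
    have hc : star v ⬝ᵥ v ≠ 0 := fun h => hv (dotProduct_star_self_eq_zero.1 h)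
    have hzero : ∀ j, j ≠ k → A j *ᵥ v = 0 := by
      intro j hj
      have h := htr j k _ hk
      rw [Matrix.trace_mul_smul_vecMulVec_star, if_neg hj] at h
      exact ((hA j).dotProduct_mulVec_zero_iff v).1
        ((mul_eq_zero.1 h).resolve_left (inv_ne_zero hc))
    by_cases hak : a = k
    · right
      have h : (∑ j, A j) *ᵥ v = v := by rw [hsum, Matrix.one_mulVec]
      rwa [Matrix.sum_mulVec, Finset.sum_eq_single_of_mem a (Finset.mem_univ a)
        fun j _ hj => hzero j (hak ▸ hj)] at h
    · exact Or.inl (hzero a hak)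
  rcases Matrix.eq_zero_or_eq_one_of_mulVec key with h | h
  · simp [h] at haρ
  · simp [h, hpure hσ] at haσ
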